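/- For n ≥ 3, the cycle graph C_n on n vertices is ensnaring if and only if n is odd. -/

import Mathlib

open scoped Classical

/-- The state space `Ξₙ` for a graph on vertex set `V` with `n = |V|`: a state `(v, i, ε)`
consists of a bijection `v` from the vertices to the positions `ℤ/n` (the replica of vertex
`a` sits at position `v a`; positions increase clockwise), the index `i : ℤ/n`, and the
orientation `ε ∈ {±1}` encoded as a `Bool` (`true` = `+1`, `false` = `-1`). -/
abbrev Xi (V : Type*) [Fintype V] : Type _ :=
  (V ≃ ZMod (Fintype.card V)) × ZMod (Fintype.card V) × Bool

/-- The orientation `ε` as an element of `ℤ/n`. -/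
def epsZ (n : ℕ) (e : Bool) : ZMod n := if e then 1 else -1

/-- Refractive toric promotion `Θ_G`:
`Θ_G (v,i,ε) = (s̄ᵢ v, i+ε, ε)` if `{v⁻¹(i), v⁻¹(i+1)}` is not an edge of `G`, and
`Θ_G (v,i,ε) = (s̄ᵢ v, i−ε, −ε)` if it is an edge of `G`.  Here `s̄ᵢ v` swaps the replicas
sitting at positions `i` and `i+1`. -/
noncomputable def theta {V : Type*} [Fintype V] (G : SimpleGraph V) (D : Xi V) : Xi V :=
  if G.Adj (D.1.symm D.2.1) (D.1.symm (D.2.1 + 1)) then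
    (D.1.trans (Equiv.swap D.2.1 (D.2.1 + 1)), D.2.1 - epsZ _ D.2.2, !D.2.2)
  else
    (D.1.trans (Equiv.swap D.2.1 (D.2.1 + 1)), D.2.1 + epsZ _ D.2.2, D.2.2)

/-- The net number of clockwise steps that the replica of vertex `a` makes during one
application of `Θ_G` to the state `D`: each application swaps the replicas at positions
`i` and `i+1`, moving the former one step clockwise and the latter one step
counterclockwise. -/
def disp {V : Type*} [Fintype V] (D : Xi V) (a : V) : ℤ :=
  if D.1 a = D.2.1 then 1 else if D.1 a = D.2.1 + 1 then -1 else 0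

/-- `n` times the winding number `w_O(a)` of vertex `a` with respect to the orbit `O` of the
state `D` under `Θ_G`: the net number of clockwise steps made by the replica of `a` during
`P` consecutive applications of `Θ_G` starting from `D`, where `P` is the size of the orbit
(i.e. the minimal period of `D`).  The winding number itself is `windSum G D a / n`; in
particular `w_O(a) = 0` iff `windSum G D a = 0`, and `w_O(a) = w_O(b)` iff
`windSum G D a = windSum G D b`. -/
noncomputable def windSum {V : Type*} [Fintype V] (G : SimpleGraph V) (D : Xi V) (a : V) : ℤ :=
  ∑ k ∈ Finset.range (Function.minimalPeriod (theta G) D), disp ((theta G)^[k] D) a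

/-- The winding vector of the orbit of `D` under `Θ_G` is zero. -/
def WindingVectorZero {V : Type*} [Fintype V] (G : SimpleGraph V) (D : Xi V) : Prop :=
  ∀ a : V, windSum G D a = 0

/-- `G` is ensnaring if every orbit of `Θ_G` has winding vector `0`. -/
def Ensnaring {V : Type*} [Fintype V] (G : SimpleGraph V) : Prop :=
  ∀ D : Xi V, WindingVectorZero G D

/-- `G` is expelling if no orbit of `Θ_G` has winding vector `0`. -/
def Expelling {V : Type*} [Fintype V] (G : SimpleGraph V) : Prop :=
  ∀ D : Xi V, ¬ WindingVectorZero G D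

section helpers
variable {V : Type*} [Fintype V] (G : SimpleGraph V)

def cpos (D : Xi V) : ZMod (Fintype.card V) := if D.2.2 then D.2.1 else D.2.1 + 1

theorem fpos_eq (D : Xi V) : cpos D + epsZ _ D.2.2 = if D.2.2 then D.2.1 + 1 else D.2.1 := by
  unfold cpos epsZ; split_ifs <;> ring

theorem swap_eq (D : Xi V) : Equiv.swap D.2.1 (D.2.1 + 1) =
    Equiv.swap (cpos D) (cpos D + epsZ _ D.2.2) := by
  rw [fpos_eq]; unfold cpos; split_ifs
  · rfl
  · rw [Equiv.swap_comm]

theorem adj_iff (D : Xi V) : G.Adj (D.1.symm D.2.1) (D.1.symm (D.2.1 + 1)) ↔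
    G.Adj (D.1.symm (cpos D)) (D.1.symm (cpos D + epsZ _ D.2.2)) := by
  rw [fpos_eq]; unfold cpos; split_ifs
  · rfl
  · rw [G.adj_comm]

theorem theta_fst (D : Xi V) : (theta G D).1 =
    D.1.trans (Equiv.swap (cpos D) (cpos D + epsZ _ D.2.2)) := by
  rw [← swap_eq]; unfold theta; split_ifs <;> rfl

theorem theta_adj (D : Xi V)
    (h : G.Adj (D.1.symm (cpos D)) (D.1.symm (cpos D + epsZ _ D.2.2))) :
    cpos (theta G D) = cpos D ∧ (theta G D).2.2 = !D.2.2 := by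
  rw [← adj_iff] at h
  obtain ⟨v, i, e⟩ := D
  cases e <;> simp_all [theta, cpos, epsZ]

theorem theta_nonadj (D : Xi V)
    (h : ¬ G.Adj (D.1.symm (cpos D)) (D.1.symm (cpos D + epsZ _ D.2.2))) :
    cpos (theta G D) = cpos D + epsZ _ D.2.2 ∧ (theta G D).2.2 = D.2.2 := by
  rw [← adj_iff] at h
  obtain ⟨v, i, e⟩ := D
  cases e <;> simp_all [theta, cpos, epsZ]

theorem state_ext (D D' : Xi V) (h1 : D.1 = D'.1) (h2 : cpos D = cpos D') (h3 : D.2.2 = D'.2.2) :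
    D = D' := by
  obtain ⟨v, i, e⟩ := D
  obtain ⟨v', i', e'⟩ := D'
  simp only at h1 h3
  subst h1 h3
  cases e <;> simp_all [cpos]

theorem theta_injective : Function.Injective (theta G) := by
  let R : Xi V → Xi V := fun D => (D.1, D.2.1 - epsZ _ D.2.2, !D.2.2)
  have : Function.LeftInverse (fun D => R (theta G (R D))) (theta G) := by
    rintro ⟨v, i, e⟩
    have key : ∀ w : V ≃ ZMod (Fintype.card V), ∀ a b, (w.trans (Equiv.swap a b)).trans (Equiv.swap a b) = w := by
      intro w a b; ext x; simp
    by_cases h : G.Adj (v.symm i) (v.symm (i + 1))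
    · have h' := h.symm
      cases e <;> simp [theta, R, epsZ, h, h', key]
    · have h' : ¬ G.Adj (v.symm (i+1)) (v.symm i) := fun h' => h h'.symm
      cases e <;> simp [theta, R, epsZ, h, h', key]
  exact this.injective

theorem periodic [NeZero (Fintype.card V)] (D : Xi V) : D ∈ Function.periodicPts (theta G) :=
  (theta_injective G).mem_periodicPts D

theorem windSum_theta [NeZero (Fintype.card V)] (D : Xi V) (a : V) :
    windSum G (theta G D) a = windSum G D a := by
  unfold windSum
  rw [Function.minimalPeriod_apply (periodic G D)]
  have h1 := Finset.sum_range_succ (fun k => disp ((theta G)^[k] D) a)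
    (Function.minimalPeriod (theta G) D)
  have h2 := Finset.sum_range_succ' (fun k => disp ((theta G)^[k] D) a)
    (Function.minimalPeriod (theta G) D)
  simp only [Function.iterate_minimalPeriod, Function.iterate_succ_apply,
    Function.iterate_zero, id] at h1 h2
  linarith

theorem windSum_iter [NeZero (Fintype.card V)] (m : ℕ) (D : Xi V) (a : V) :
    windSum G ((theta G)^[m] D) a = windSum G D a := by
  induction m generalizing D with
  | zero => rfl
  | succ m ih => rw [Function.iterate_succ_apply, ih, windSum_theta]

theorem sum_disp (h3 : 3 ≤ Fintype.card V) (D : Xi V) (f : V → ℤ) :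
    ∑ a, f a * disp D a = f (D.1.symm D.2.1) - f (D.1.symm (D.2.1 + 1)) := by
  have hne : (1 : ZMod (Fintype.card V)) ≠ 0 := by
    have : Fact (1 < Fintype.card V) := ⟨by omega⟩
    exact one_ne_zero
  have : ∀ a, f a * disp D a = (if a = D.1.symm D.2.1 then f a else 0)
      - (if a = D.1.symm (D.2.1 + 1) then f a else 0) := by
    intro a
    unfold disp
    simp only [Equiv.eq_symm_apply]
    split_ifs with h1 h2 h2
    · rw [h1] at h2; exact absurd (by simpa using h2) hne
    all_goals simp
  simp [this, Finset.sum_sub_distrib]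

theorem sum_windSum (h3 : 3 ≤ Fintype.card V) (D : Xi V) : ∑ a, windSum G D a = 0 := by
  unfold windSum
  rw [Finset.sum_comm]
  apply Finset.sum_eq_zero
  intro k _
  simpa using sum_disp h3 ((theta G)^[k] D) (fun _ => 1)

/-- symmetry -/
def Phi (p : Equiv.Perm V) (κ : ZMod (Fintype.card V)) (D : Xi V) : Xi V :=
  ((p.symm.trans D.1).trans (Equiv.addRight κ), D.2.1 + κ, D.2.2)

theorem Phi_injective (p : Equiv.Perm V) (κ : ZMod (Fintype.card V)) :
    Function.Injective (Phi p κ) := by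
  rintro ⟨v, i, e⟩ ⟨v', i', e'⟩ h
  simp only [Phi, Prod.mk.injEq] at h
  obtain ⟨h1, h2, h3⟩ := h
  have : v = v' := by
    ext x
    have := congrArg (fun q : V ≃ ZMod (Fintype.card V) => q (p x)) h1
    simpa using this
  simp_all

theorem Phi_theta (p : Equiv.Perm V) (hp : ∀ a b, G.Adj (p a) (p b) ↔ G.Adj a b)
    (κ : ZMod (Fintype.card V)) (D : Xi V) :
    theta G (Phi p κ D) = Phi p κ (theta G D) := by
  obtain ⟨v, i, e⟩ := D
  have hA : G.Adj ((Phi p κ (v, i, e)).1.symm (i + κ)) ((Phi p κ (v, i, e)).1.symm (i + κ + 1))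
      ↔ G.Adj (v.symm i) (v.symm (i + 1)) := by
    have : i + κ + 1 = (i + 1) + κ := by ring
    rw [this]
    simp [Phi, hp]
  have hS : (Phi p κ (v, i, e)).1.trans (Equiv.swap (i + κ) (i + κ + 1)) =
      (p.symm.trans (v.trans (Equiv.swap i (i+1)))).trans (Equiv.addRight κ) := by
    have : i + κ + 1 = (i + 1) + κ := by ring
    rw [this]
    ext x
    simp only [Phi, Equiv.trans_apply, Equiv.coe_addRight, Equiv.swap_apply_def, add_left_inj]
    split_ifs <;> simp
  unfold theta
  have e1 : (Phi p κ (v, i, e)).2.1 = i + κ := rfl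
  have e2 : (Phi p κ (v, i, e)).2.2 = e := rfl
  simp only [e1, e2, hA, hS]
  split_ifs
  · simp only [Phi, Prod.mk.injEq, and_true, true_and]; ring
  · simp only [Phi, Prod.mk.injEq, and_true, true_and]; ring

theorem windSum_Phi (p : Equiv.Perm V) (hp : ∀ a b, G.Adj (p a) (p b) ↔ G.Adj a b)
    (κ : ZMod (Fintype.card V)) (D : Xi V) (a : V) :
    windSum G (Phi p κ D) (p a) = windSum G D a := by
  have hit : ∀ k D, (theta G)^[k] (Phi p κ D) = Phi p κ ((theta G)^[k] D) := by
    intro k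
    induction k with
    | zero => intro D; rfl
    | succ k ih => intro D; rw [Function.iterate_succ_apply, Function.iterate_succ_apply,
        Phi_theta G p hp, ih]
  have hmp : Function.minimalPeriod (theta G) (Phi p κ D) = Function.minimalPeriod (theta G) D := by
    rw [Function.minimalPeriod_eq_minimalPeriod_iff]
    intro k
    unfold Function.IsPeriodicPt Function.IsFixedPt
    rw [hit, (Phi_injective p κ).eq_iff]
  unfold windSum
  rw [hmp]
  apply Finset.sum_congr rfl
  intro k _
  rw [hit]
  unfold disp
  have : ∀ i : ZMod (Fintype.card V), i + κ + 1 = (i + 1) + κ := by intro i; ring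
  simp [Phi, this]

theorem reach_adj (a b : V) (hab : G.Adj a b) (d : ℕ) (D : Xi V) (ha : D.1 a = cpos D)
    (hb : D.1 b = cpos D + epsZ (Fintype.card V) D.2.2 * ((d : ZMod (Fintype.card V)) + 1)) :
    ∃ m, G.Adj (((theta G)^[m] D).1.symm (cpos ((theta G)^[m] D)))
      (((theta G)^[m] D).1.symm (cpos ((theta G)^[m] D) + epsZ _ ((theta G)^[m] D).2.2)) := by
  induction d generalizing D with
  | zero =>
    refine ⟨0, ?_⟩
    simp only [Nat.cast_zero, zero_add, mul_one] at hb
    simp only [Function.iterate_zero, id]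
    rw [← hb, ← ha]
    simpa using hab
  | succ d ih =>
    by_cases h : G.Adj (D.1.symm (cpos D)) (D.1.symm (cpos D + epsZ _ D.2.2))
    · exact ⟨0, h⟩
    · obtain ⟨h1, h2⟩ := theta_nonadj G D h
      have hb1 : D.1 b ≠ cpos D := by
        rw [← ha]; exact fun hh => hab.ne (D.1.injective hh).symm
      have hb2 : D.1 b ≠ cpos D + epsZ _ D.2.2 := by
        intro hh
        apply h
        rw [← hh, ← ha]
        simpa using hab
      obtain ⟨m, hm⟩ := ih (theta G D) (by simp [theta_fst, ha, h1]) (by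
        rw [theta_fst, Equiv.trans_apply, Equiv.swap_apply_of_ne_of_ne hb1 hb2, h1, h2, hb]
        push_cast; ring)
      exact ⟨m + 1, by simpa only [Function.iterate_succ_apply] using hm⟩

theorem epsZ_sq (n : ℕ) (e : Bool) : epsZ n e * epsZ n e = 1 := by
  cases e <;> simp [epsZ]

theorem reach_adj' [NeZero (Fintype.card V)] (hG : ∀ a, ∃ b, G.Adj a b) (D : Xi V) :
    ∃ m, G.Adj (((theta G)^[m] D).1.symm (cpos ((theta G)^[m] D)))
      (((theta G)^[m] D).1.symm (cpos ((theta G)^[m] D) + epsZ _ ((theta G)^[m] D).2.2)) := by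
  obtain ⟨b, hb⟩ := hG (D.1.symm (cpos D))
  apply reach_adj G _ b hb (epsZ _ D.2.2 * (D.1 b - cpos D) - 1).val D (by simp)
  rw [ZMod.natCast_zmod_val]
  linear_combination (- (D.1 b - cpos D)) * epsZ_sq _ D.2.2

theorem not_ensnaring_of_bip (h3 : 3 ≤ Fintype.card V) (col : V → Bool)
    (hcol : ∀ a b, G.Adj a b → col b = !(col a)) (D : Xi V) (h0 : col (D.1.symm (cpos D)) = D.2.2)
    (h1 : G.Adj (D.1.symm (cpos D)) (D.1.symm (cpos D + epsZ _ D.2.2))) :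
    ¬ Ensnaring G := by
  intro hE
  have : NeZero (Fintype.card V) := ⟨by omega⟩
  have hinv : ∀ k, col (((theta G)^[k] D).1.symm (cpos ((theta G)^[k] D)))
      = ((theta G)^[k] D).2.2 := by
    intro k
    induction k with
    | zero => exact h0
    | succ k ih =>
      rw [Function.iterate_succ_apply']
      generalize (theta G)^[k] D = D at ih
      by_cases h : G.Adj (D.1.symm (cpos D)) (D.1.symm (cpos D + epsZ _ D.2.2))
      · obtain ⟨e1, e2⟩ := theta_adj G D h
        rw [e1, e2, theta_fst]
        have h9 := hcol _ _ h
        rw [ih] at h9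
        rw [← h9]
        simp
      · obtain ⟨e1, e2⟩ := theta_nonadj G D h
        rw [e1, e2, theta_fst]
        simpa using ih
  let f : V → ℤ := fun a => if col a then 1 else 0
  have hs : ∀ D : Xi V, col (D.1.symm (cpos D)) = D.2.2 → 0 ≤ ∑ a, f a * disp D a := by
    rintro ⟨v, i, e⟩ h
    rw [sum_disp h3]
    cases e <;> simp_all [f, cpos] <;> split_ifs <;> simp
  have hs0 : 0 < ∑ a, f a * disp D a := by
    have := hcol _ _ h1
    obtain ⟨v, i, e⟩ := D
    rw [sum_disp h3]
    cases e <;> simp_all [f, cpos, epsZ]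
  have htot : ∑ a, f a * windSum G D a = 0 := by simp [hE D _]
  unfold windSum at htot
  simp only [Finset.mul_sum] at htot
  rw [Finset.sum_comm] at htot
  have hP := Function.minimalPeriod_pos_of_mem_periodicPts (periodic G D)
  have := (Finset.sum_eq_zero_iff_of_nonneg (fun k _ => hs _ (hinv k))).1 htot 0 (by simpa using hP)
  simp only [Function.iterate_zero, id] at this
  omega

end helpers
section cyc
variable {V : Type*} [Fintype V] (G : SimpleGraph V) (M : ℕ) (hM : Fintype.card V = M + 1)
  (h2 : 2 ≤ M) (L : ZMod (Fintype.card V) ≃ V)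
  (hL : ∀ a b, G.Adj (L a) (L b) ↔ b = a + 1 ∨ a = b + 1)
  (c : ℕ → ZMod M)

def TRep (D : Xi V) (t : ℕ) (g : ZMod M) : Prop :=
  D.1 (L t) = cpos D ∧ ∀ k : ℕ, 1 ≤ k → k ≤ M → ∃ r : ℕ, 1 ≤ r ∧ r ≤ M ∧
    D.1 (L ((t + k : ℕ) : ZMod (Fintype.card V))) = cpos D + (r : ZMod (Fintype.card V)) ∧
    c (t + k) = g + r

def fr (g : ZMod M) (e : Bool) : ZMod M := if e then g + 1 else g

/-- the offset of the front -/
def fo (e : Bool) : ℕ := if e then 1 else M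

include hM in
theorem cast_M1 : (M : ZMod (Fintype.card V)) = -1 := by
  have : ((M + 1 : ℕ) : ZMod (Fintype.card V)) = 0 := by rw [← hM]; exact ZMod.natCast_self _
  push_cast at this
  linear_combination this

include hM in
theorem castV_inj (a b : ℕ) (ha : a ≤ M) (hb : b ≤ M)
    (h : (a : ZMod (Fintype.card V)) = b) : a = b := by
  have := (ZMod.natCast_eq_natCast_iff a b _).1 h
  exact Nat.ModEq.eq_of_lt_of_lt this (by omega) (by omega)

include hM in
theorem fo_cast (e : Bool) : ((fo M e : ℕ) : ZMod (Fintype.card V)) = epsZ _ e := by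
  cases e <;> simp [fo, epsZ, cast_M1 M hM]

theorem fo_cast' (e : Bool) (g : ZMod M) : g + ((fo M e : ℕ) : ZMod M) = fr M g e := by
  cases e <;> simp [fo, fr]

include h2 in
theorem fo_range (e : Bool) : 1 ≤ fo M e ∧ fo M e ≤ M := by
  cases e <;> simp [fo] <;> omega

theorem slot_inj (a b : ℕ) (ha : 1 ≤ a) (ha' : a ≤ M) (hb : 1 ≤ b) (hb' : b ≤ M)
    (h : (a : ZMod M) = b) : a = b := by
  obtain ⟨a, rfl⟩ : ∃ a', a = a' + 1 := ⟨a - 1, by omega⟩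
  obtain ⟨b, rfl⟩ : ∃ a', b = a' + 1 := ⟨b - 1, by omega⟩
  push_cast at h
  have := (ZMod.natCast_eq_natCast_iff a b _).1 (by simpa using h)
  have := Nat.ModEq.eq_of_lt_of_lt this (by omega) (by omega)
  omega

include hM h2 in
theorem eps_ne (e : Bool) : epsZ (Fintype.card V) e ≠ 0 := by
  rw [← fo_cast M hM]
  intro h
  have h' : ((fo M e : ℕ) : ZMod (Fintype.card V)) = ((0 : ℕ) : ZMod (Fintype.card V)) := by
    simpa using h
  have := castV_inj M hM _ 0 (fo_range M h2 e).2 (by omega) h'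
  have := (fo_range M h2 e).1
  omega

include hM in
theorem exists_k (t : ℕ) (x : V) (hx : x ≠ L t) :
    ∃ k : ℕ, 1 ≤ k ∧ k ≤ M ∧ x = L ((t + k : ℕ) : ZMod (Fintype.card V)) := by
  have : NeZero (Fintype.card V) := ⟨by omega⟩
  have h1 : ((L.symm x - (t : ZMod (Fintype.card V))).val : ZMod (Fintype.card V)) = L.symm x - (t : ZMod (Fintype.card V)) := ZMod.natCast_zmod_val _
  refine ⟨(L.symm x - (t : ZMod (Fintype.card V))).val, ?_, ?_, ?_⟩
  · by_contra h
    have h0 : (L.symm x - (t : ZMod (Fintype.card V))).val = 0 := by omega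
    rw [h0, Nat.cast_zero] at h1
    apply hx
    rw [← L.symm_apply_eq]
    linear_combination -h1
  · have := ZMod.val_lt (L.symm x - (t : ZMod (Fintype.card V)))
    omega
  · rw [← L.symm_apply_eq]
    push_cast
    rw [h1]; ring

include hM h2 in
/-- location of the front -/
theorem front_iff (D : Xi V) (t : ℕ) (g : ZMod M) (hR : TRep M L c D t g) (k : ℕ)
    (hk : 1 ≤ k) (hk' : k ≤ M) :
    D.1 (L ((t + k : ℕ) : ZMod (Fintype.card V))) = cpos D + epsZ _ D.2.2 ↔
      c (t + k) = fr M g D.2.2 := by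
  obtain ⟨r, h1, h3, h4, h5⟩ := hR.2 k hk hk'
  obtain ⟨f1, f2⟩ := fo_range M h2 D.2.2
  rw [h4, h5, ← fo_cast M hM, ← fo_cast', add_right_inj, add_right_inj]
  constructor
  · intro h; rw [castV_inj M hM r _ h3 f2 h]
  · intro h; rw [slot_inj M r _ h1 h3 f1 f2 h]

include hM h2 hL in
theorem step_non (D : Xi V) (t : ℕ) (g : ZMod M) (hR : TRep M L c D t g)
    (n1 : fr M g D.2.2 ≠ c (t + 1)) (n2 : fr M g D.2.2 ≠ c (t + M)) :
    TRep M L c (theta G D) t (g + epsZ M D.2.2) ∧ (theta G D).2.2 = D.2.2 := by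
  have hne := eps_ne (V := V) M hM h2 D.2.2
  have hcar : D.1.symm (cpos D) = L t := by rw [← hR.1]; simp
  obtain ⟨q, q1, q2, q3⟩ := exists_k M hM L t (D.1.symm (cpos D + epsZ _ D.2.2)) (by
    rw [← hcar]; simpa using hne)
  have hq : D.1 (L ((t + q : ℕ) : ZMod (Fintype.card V))) = cpos D + epsZ _ D.2.2 := by
    rw [← q3]; simp
  have hqc := (front_iff M hM h2 L c D t g hR q q1 q2).1 hq
  have hna : ¬ G.Adj (D.1.symm (cpos D)) (D.1.symm (cpos D + epsZ _ D.2.2)) := by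
    rw [hcar, q3, hL]
    push_cast
    rintro (h | h)
    · have : (q : ZMod (Fintype.card V)) = (1 : ℕ) := by push_cast; linear_combination h
      have := castV_inj M hM q 1 q2 (by omega) this
      subst this
      exact n1 hqc.symm
    · have : (q : ZMod (Fintype.card V)) = (M : ℕ) := by
        rw [cast_M1 M hM]; linear_combination -h
      have := castV_inj M hM q M q2 (by omega) this
      subst this
      exact n2 hqc.symm
  obtain ⟨p1, p2⟩ := theta_nonadj G D hna
  refine ⟨⟨?_, ?_⟩, p2⟩
  · rw [theta_fst, Equiv.trans_apply, hR.1, p1, Equiv.swap_apply_left]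
  · intro k hk hk'
    rw [theta_fst, Equiv.trans_apply, p1]
    obtain ⟨r, r1, r2, r3, r4⟩ := hR.2 k hk hk'
    have hfk := front_iff M hM h2 L c D t g hR k hk hk'
    by_cases hkq : D.1 (L ((t + k : ℕ) : ZMod (Fintype.card V))) = cpos D + epsZ _ D.2.2
    · rw [hkq, Equiv.swap_apply_right, hfk.1 hkq]
      obtain ⟨f1, f2⟩ := fo_range M h2 (!D.2.2)
      refine ⟨fo M (!D.2.2), f1, f2, ?_, ?_⟩
      · rw [fo_cast M hM]; cases D.2.2 <;> simp [epsZ]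
      · cases D.2.2 <;> simp [epsZ, fo, fr]
    · have h0 : D.1 (L ((t + k : ℕ) : ZMod (Fintype.card V))) ≠ cpos D := by
        rw [r3]
        intro h
        have : (r : ZMod (Fintype.card V)) = ((0 : ℕ) : ZMod (Fintype.card V)) := by simpa using h
        have := castV_inj M hM _ _ r2 (by omega) this
        omega
      rw [Equiv.swap_apply_of_ne_of_ne h0 hkq, r3, r4]
      have hrf : r ≠ fo M D.2.2 := by
        rintro rfl
        exact hkq (by rw [r3, fo_cast M hM])
      cases he : D.2.2
      · simp only [he, fo] at hrf
        refine ⟨r + 1, by omega, ?_, ?_, ?_⟩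
        · simp at hrf; omega
        · simp [epsZ]; ring
        · simp [epsZ]; ring
      · simp only [he, fo] at hrf
        obtain ⟨r, rfl⟩ : ∃ a', r = a' + 1 := ⟨r - 1, by omega⟩
        refine ⟨r, ?_, by omega, ?_, ?_⟩
        · simp at hrf; omega
        · simp [epsZ]; ring
        · simp [epsZ]; ring

include hM h2 hL in
theorem step_edge (hc : ∀ t, c (t + 1 + M) = c (t + 1)) (D : Xi V) (t : ℕ) (g : ZMod M)
    (hR : TRep M L c D t g) (n1 : fr M g D.2.2 = c (t + 1)) :
    TRep M L c (theta G D) (t + 1) g ∧ (theta G D).2.2 = !D.2.2 := by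
  have hcar : D.1.symm (cpos D) = L t := by rw [← hR.1]; simp
  have hf := (front_iff M hM h2 L c D t g hR 1 (by omega) (by omega)).2 n1.symm
  have hf' : D.1.symm (cpos D + epsZ _ D.2.2) = L ((t + 1 : ℕ) : ZMod (Fintype.card V)) := by
    rw [← hf]; simp
  have ha : G.Adj (D.1.symm (cpos D)) (D.1.symm (cpos D + epsZ _ D.2.2)) := by
    rw [hcar, hf', hL]; left; push_cast; ring
  obtain ⟨p1, p2⟩ := theta_adj G D ha
  refine ⟨⟨?_, ?_⟩, p2⟩
  · rw [theta_fst, Equiv.trans_apply, hf, p1, Equiv.swap_apply_right]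
  · intro k hk hk'
    rw [theta_fst, Equiv.trans_apply, p1]
    by_cases hkM : k = M
    · subst hkM
      have : ((t + 1 + k : ℕ) : ZMod (Fintype.card V)) = t := by
        push_cast; rw [cast_M1 k hM]; ring
      obtain ⟨f1, f2⟩ := fo_range k h2 D.2.2
      refine ⟨fo k D.2.2, f1, f2, ?_, ?_⟩
      · rw [this, hR.1, Equiv.swap_apply_left, fo_cast k hM]
      · rw [fo_cast', hc, n1]
    · obtain ⟨r, r1, r2, r3, r4⟩ := hR.2 (k + 1) (by omega) (by omega)
      have e : t + 1 + k = t + (k + 1) := by ring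
      rw [e]
      have hn0 : D.1 (L ((t + (k + 1) : ℕ) : ZMod (Fintype.card V))) ≠ cpos D := by
        rw [← hR.1]
        intro h
        have h := L.injective (D.1.injective h)
        push_cast at h
        have : ((k + 1 : ℕ) : ZMod (Fintype.card V)) = ((0 : ℕ) : ZMod (Fintype.card V)) := by
          push_cast; linear_combination h
        have := castV_inj M hM _ _ (by omega) (by omega) this
        omega
      have hn1 : D.1 (L ((t + (k + 1) : ℕ) : ZMod (Fintype.card V))) ≠
          cpos D + epsZ _ D.2.2 := by
        rw [← hf]
        intro h
        have h := L.injective (D.1.injective h)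
        push_cast at h
        have : (k : ZMod (Fintype.card V)) = ((0 : ℕ) : ZMod (Fintype.card V)) := by
          push_cast; linear_combination h
        have := castV_inj M hM _ _ (by omega) (by omega) this
        omega
      refine ⟨r, r1, r2, ?_, r4⟩
      rw [Equiv.swap_apply_of_ne_of_ne hn0 hn1, r3]

theorem fr_add (g : ZMod M) (e : Bool) (x : ZMod M) : fr M (g + x) e = fr M g e + x := by
  cases e <;> simp [fr]; ring

include hM h2 hL in
theorem scan (d : ℕ) (D : Xi V) (t : ℕ) (g : ZMod M) (hR : TRep M L c D t g)
    (hd : ∀ e < d, fr M g D.2.2 + epsZ M D.2.2 * e ≠ c (t + 1) ∧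
      fr M g D.2.2 + epsZ M D.2.2 * e ≠ c (t + M)) :
    TRep M L c ((theta G)^[d] D) t (g + epsZ M D.2.2 * d) ∧ ((theta G)^[d] D).2.2 = D.2.2 := by
  induction d with
  | zero => simpa using hR
  | succ d ih =>
    obtain ⟨a1, a2⟩ := ih (fun e he => hd e (by omega))
    obtain ⟨b1, b2⟩ := hd d (by omega)
    rw [Function.iterate_succ_apply']
    have := step_non G M hM h2 L hL c _ t _ a1 (by rwa [a2, fr_add]) (by rwa [a2, fr_add])
    rw [a2] at this
    refine ⟨?_, this.2⟩
    convert this.1 using 1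
    push_cast; ring

include hM h2 hL in
theorem bounce (hc : ∀ t, c (t + 1 + M) = c (t + 1)) (D : Xi V) (t : ℕ) (g : ZMod M)
    (hR : TRep M L c D t g) (n1 : fr M g D.2.2 = c (t + 1)) :
    ∃ m g', TRep M L c ((theta G)^[m] D) (t + 1) g' ∧
      ((theta G)^[m] D).2.2 = (!D.2.2) ∧ fr M g' (!D.2.2) = c (t + 1 + 1) := by
  obtain ⟨a1, a2⟩ := step_edge G M hM h2 L hL c hc D t g hR n1
  have : NeZero M := ⟨by omega⟩
  set e := !D.2.2 with he
  set d := (epsZ M e * (c (t + 1 + 1) - fr M g e)).val with hd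
  have hdc : (d : ZMod M) = epsZ M e * (c (t + 1 + 1) - fr M g e) := ZMod.natCast_zmod_val _
  have hdM : d < M := ZMod.val_lt _
  have hlast : c (t + 1 + M) = fr M g e - epsZ M e := by
    rw [hc, ← n1, he]; cases D.2.2 <;> simp [fr, epsZ]
  have hsq := epsZ_sq M e
  have key := scan G M hM h2 L hL c d (theta G D) (t + 1) g a1 (by
    rw [a2]
    intro x hx
    constructor
    · intro h
      have : (x : ZMod M) = (d : ZMod M) := by
        rw [hdc, ← h]; linear_combination (-(x : ZMod M)) * hsq
      have := Nat.ModEq.eq_of_lt_of_lt ((ZMod.natCast_eq_natCast_iff x d M).1 this)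
        (by omega) (by omega)
      omega
    · rw [hlast]
      intro h
      have h' : ((x + 1 : ℕ) : ZMod M) = ((0 : ℕ) : ZMod M) := by
        push_cast; linear_combination epsZ M e * h - ((x : ZMod M) + 1) * hsq
      have := Nat.ModEq.eq_of_lt_of_lt ((ZMod.natCast_eq_natCast_iff (x + 1) 0 M).1 h')
        (by omega) (by omega)
      omega)
  refine ⟨d + 1, g + epsZ M e * d, ?_, ?_, ?_⟩
  · rw [Function.iterate_succ_apply]; rw [a2] at key; exact key.1
  · rw [Function.iterate_succ_apply, key.2, a2]
  · rw [fr_add, hdc]; linear_combination (c (t + 1 + 1) - fr M g e) * hsq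

include hM h2 hL in
theorem bounces (hc : ∀ t, c (t + 1 + M) = c (t + 1)) (D : Xi V) (g : ZMod M)
    (hR : TRep M L c D 0 g) (n1 : fr M g D.2.2 = c 1) (t : ℕ) :
    ∃ m g', TRep M L c ((theta G)^[m] D) t g' ∧
      ((theta G)^[m] D).2.2 = (xor D.2.2 (Nat.bodd t)) ∧
      fr M g' ((theta G)^[m] D).2.2 = c (t + 1) := by
  induction t with
  | zero => exact ⟨0, g, hR, by simp, n1⟩
  | succ t ih =>
    obtain ⟨m, g', b1, b2, b3⟩ := ih
    obtain ⟨m', g'', c1, c2, c3⟩ := bounce G M hM h2 L hL c hc _ t g' b1 b3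
    refine ⟨m' + m, g'', ?_, ?_, ?_⟩
    · rw [Function.iterate_add_apply]; exact c1
    · rw [Function.iterate_add_apply, c2, b2]; simp
    · rw [Function.iterate_add_apply, c2, c3]


include hM h2 hL in
theorem wind_const (hMe : Even M) (D : Xi V) (h0 : D.1 (L 0) = cpos D)
    (h1 : D.1 (L 1) = cpos D + epsZ _ D.2.2) (x : ZMod (Fintype.card V)) :
    windSum G D (L (x - 1)) = windSum G D (L x) := by
  have : NeZero (Fintype.card V) := ⟨by omega⟩
  obtain ⟨c, hc, hR⟩ : ∃ c : ℕ → ZMod M, (∀ t, c (t + 1 + M) = c (t + 1)) ∧ TRep M L c D 0 0 := by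
    refine ⟨fun k => ((D.1 (L (((k - 1) % M + 1 : ℕ) : ZMod (Fintype.card V))) - cpos D).val : ZMod M),
      ?_, ?_, ?_⟩
    · intro t
      have : (t + 1 + M - 1) % M = (t + 1 - 1) % M := by
        rw [show t + 1 + M - 1 = t + M by omega]; simp
      simp only [this]
    · simpa using h0
    · intro k hk hk'
      have hmod : (0 + k - 1) % M + 1 = k := by
        rw [Nat.mod_eq_of_lt (by omega)]; omega
      refine ⟨(D.1 (L (k : ZMod (Fintype.card V))) - cpos D).val, ?_, ?_, ?_, ?_⟩
      · rw [Nat.one_le_iff_ne_zero, Ne, ZMod.val_eq_zero, sub_eq_zero, ← h0]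
        intro h
        have h := L.injective (D.1.injective h)
        have := castV_inj (V := V) M hM k 0 hk' (by omega) (by simpa using h)
        omega
      · have := ZMod.val_lt (D.1 (L (k : ZMod (Fintype.card V))) - cpos D)
        omega
      · rw [ZMod.natCast_zmod_val]; simp
      · simp only [hmod]; simp
  have n1 : fr M 0 D.2.2 = c 1 := by
    have := (front_iff M hM h2 L c D 0 0 hR 1 (by omega) (by omega)).1 (by simpa using h1)
    simpa using this.symm
  obtain ⟨m, g', b1, b2, b3⟩ := bounces G M hM h2 L hL c hc D 0 hR n1 M
  have hbo : Nat.bodd M = false := by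
    obtain ⟨k, rfl⟩ := hMe
    simp
  rw [hbo, Bool.xor_false] at b2
  have hg : g' = 0 := by
    have e : c (M + 1) = c 1 := by have := hc 0; rwa [zero_add, add_comm] at this
    rw [b2, e, ← n1] at b3
    have := fr_add M 0 D.2.2 g'
    rw [zero_add, b3] at this
    simpa using this.symm
  subst hg
  set D' := (theta G)^[m] D with hD'
  let p : Equiv.Perm V := (L.symm.trans (Equiv.subRight 1)).trans L
  have hp : ∀ a b, G.Adj (p a) (p b) ↔ G.Adj a b := by
    intro a b
    obtain ⟨a, rfl⟩ := L.surjective a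
    obtain ⟨b, rfl⟩ := L.surjective b
    simp only [p, Equiv.trans_apply, Equiv.symm_apply_apply, Equiv.subRight_apply, hL]
    constructor <;> rintro (h | h)
    · left; linear_combination h
    · right; linear_combination h
    · left; linear_combination h
    · right; linear_combination h
  have hval : ∀ y, D'.1 (L (y - 1)) = D.1 (L y) + (cpos D' - cpos D) := by
    intro y
    by_cases hy : L y = L (0 : ℕ)
    · have := L.injective hy
      subst this
      have e : (((0 : ℕ) : ZMod (Fintype.card V)) - 1) = (M : ℕ) := by
        rw [cast_M1 M hM]; simp
      rw [e, b1.1, Nat.cast_zero, h0]; ring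
    · obtain ⟨k, k1, k2, k3⟩ := exists_k M hM L 0 (L y) hy
      have := L.injective k3
      subst this
      obtain ⟨r, r1, r2, r3, r4⟩ := hR.2 k k1 k2
      obtain ⟨s, s1, s2, s3, s4⟩ := b1.2 k k1 k2
      have e : (((0 + k : ℕ) : ZMod (Fintype.card V)) - 1) = (M + k : ℕ) := by
        push_cast
        rw [cast_M1 M hM]; ring
      have ec : c (M + k) = c (0 + k) := by
        obtain ⟨k, rfl⟩ : ∃ a', k = a' + 1 := ⟨k - 1, by omega⟩
        rw [add_comm M, hc, zero_add]
      have : r = s := slot_inj M r s r1 r2 s1 s2 (by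
        rw [ec, r4] at s4; simpa using s4)
      rw [e, s3, r3, this]; ring
  have hPhi : D' = Phi p (cpos D' - cpos D) D := by
    apply state_ext
    · ext z
      obtain ⟨z, rfl⟩ := L.surjective z
      have := hval (z + 1)
      simp only [Phi, p, Equiv.trans_apply, Equiv.symm_trans_apply, Equiv.symm_symm,
        Equiv.symm_apply_apply, Equiv.coe_addRight, Equiv.subRight_symm_apply]
      rw [← this]; simp
    · have : ∀ κ, cpos (Phi p κ D) = cpos D + κ := by
        intro κ
        unfold cpos Phi
        simp only
        split_ifs <;> ring
      rw [this]; ring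
    · exact b2
  have e1 := windSum_Phi G p hp (cpos D' - cpos D) D (L x)
  rw [← hPhi, hD', windSum_iter] at e1
  simpa [p] using e1

end cyc
theorem cycle_L (m : ℕ) : ∃ L : ZMod (Fintype.card (Fin (m + 2))) ≃ Fin (m + 2),
    ∀ a b, (SimpleGraph.cycleGraph (m + 2)).Adj (L a) (L b) ↔ b = a + 1 ∨ a = b + 1 := by
  let e : ZMod (Fintype.card (Fin (m + 2))) ≃+* ZMod (m + 2) :=
    ZMod.ringEquivCongr (Fintype.card_fin (m + 2))
  refine ⟨e.toEquiv, fun a b => ?_⟩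
  rw [SimpleGraph.cycleGraph_adj]
  have h1 : ∀ x y : ZMod (Fintype.card (Fin (m + 2))), e x - e y = 1 ↔ x = y + 1 := by
    intro x y
    rw [← map_sub, ← map_one e, e.injective.eq_iff]
    constructor <;> intro h <;> linear_combination h
  exact (or_congr (h1 a b) (h1 b a)).trans or_comm

theorem odd_case {V : Type*} [Fintype V] (G : SimpleGraph V) (h3 : 3 ≤ Fintype.card V)
    (hodd : Odd (Fintype.card V)) (L : ZMod (Fintype.card V) ≃ V)
    (hL : ∀ a b, G.Adj (L a) (L b) ↔ b = a + 1 ∨ a = b + 1) : Ensnaring G := by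
  intro D a
  have : NeZero (Fintype.card V) := ⟨by omega⟩
  obtain ⟨M, hM⟩ : ∃ M, Fintype.card V = M + 1 := ⟨Fintype.card V - 1, by omega⟩
  have h2 : 2 ≤ M := by omega
  have hMe : Even M := by
    rw [hM] at hodd
    rcases Nat.even_or_odd M with h | h
    · exact h
    · exact absurd hodd (by simpa using h.add_one)
  obtain ⟨m, hm⟩ := reach_adj' G (fun a => ⟨L (L.symm a + 1), by
    have := (hL (L.symm a) (L.symm a + 1)).2 (Or.inl rfl)
    simpa using this⟩) D
  rw [← windSum_iter G m D a]
  generalize (theta G)^[m] D = D at hm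
  obtain ⟨x, hx⟩ := L.surjective (D.1.symm (cpos D))
  obtain ⟨y, hy⟩ := L.surjective (D.1.symm (cpos D + epsZ _ D.2.2))
  rw [← hx, ← hy, hL] at hm
  have hx' : D.1 (L x) = cpos D := by rw [hx]; simp
  have hy' : D.1 (L y) = cpos D + epsZ _ D.2.2 := by rw [hy]; simp
  have hconst : ∀ z, windSum G D (L (z - 1)) = windSum G D (L z) := by
    rcases hm with h | h
    · have hw := wind_const G M hM h2 ((Equiv.addRight x).trans L) (by
        intro a b
        simp only [Equiv.trans_apply, Equiv.coe_addRight, hL]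
        constructor <;> rintro (h | h)
        · left; linear_combination h
        · right; linear_combination h
        · left; linear_combination h
        · right; linear_combination h) hMe D (by simpa using hx')
          (by rw [← hy', h]; simp [add_comm])
      intro z
      have := hw (z - x)
      simp only [Equiv.trans_apply, Equiv.coe_addRight] at this
      convert this using 3 <;> ring
    · have hw := wind_const G M hM h2 ((Equiv.subLeft x).trans L) (by
        intro a b
        simp only [Equiv.trans_apply, Equiv.subLeft_apply, hL]
        constructor <;> rintro (h | h)
        · right; linear_combination h
        · left; linear_combination h
        · right; linear_combination h
        · left; linear_combination h) hMe D (by simpa using hx')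
          (by rw [← hy', h]; simp)
      intro z
      have := hw (x - z + 1)
      simp only [Equiv.trans_apply, Equiv.subLeft_apply] at this
      convert this.symm using 3 <;> ring
  have hall : ∀ k : ℕ, windSum G D (L (k : ZMod (Fintype.card V))) = windSum G D (L 0) := by
    intro k
    induction k with
    | zero => simp
    | succ k ih =>
      rw [← ih, ← hconst]; simp
  have hall' : ∀ b, windSum G D b = windSum G D (L 0) := by
    intro b
    have := hall (L.symm b).val
    rw [ZMod.natCast_zmod_val] at this
    simpa using this
  have hs := sum_windSum G h3 D
  rw [Finset.sum_congr rfl (fun b _ => hall' b)] at hs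
  simp only [Finset.sum_const, Finset.card_univ, nsmul_eq_mul, mul_eq_zero] at hs
  rw [hall']
  rcases hs with h | h
  · exfalso
    have : Fintype.card V = 0 := by exact_mod_cast h
    omega
  · exact h

theorem even_case {V : Type*} [Fintype V] (G : SimpleGraph V) (h3 : 3 ≤ Fintype.card V)
    (heven : Even (Fintype.card V)) (L : ZMod (Fintype.card V) ≃ V)
    (hL : ∀ a b, G.Adj (L a) (L b) ↔ b = a + 1 ∨ a = b + 1) : ¬ Ensnaring G := by
  let φ := ZMod.castHom heven.two_dvd (ZMod 2)
  have h01 : ∀ z : ZMod 2, decide (z + 1 = 0) = !decide (z = 0) := by decide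
  refine not_ensnaring_of_bip G h3 (fun a => decide (φ (L.symm a) = 0)) ?_
    (L.symm, 0, true) ?_ ?_
  · intro a b h
    obtain ⟨a, rfl⟩ := L.surjective a
    obtain ⟨b, rfl⟩ := L.surjective b
    rw [hL] at h
    simp only [Equiv.symm_apply_apply]
    rcases h with rfl | rfl
    · rw [map_add, map_one, h01]
    · rw [map_add, map_one, h01, Bool.not_not]
  · simp [cpos]
  · simp [cpos, epsZ, hL]

/-- For `n ≥ 3`, the cycle graph `C_n` on `n` vertices is ensnaring if and
only if `n` is odd. -/
theorem stmt_4 (n : ℕ) (hn : 3 ≤ n) :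
    Ensnaring (SimpleGraph.cycleGraph n) ↔ Odd n := by
  obtain ⟨m, rfl⟩ : ∃ m, n = m + 2 := ⟨n - 2, by omega⟩
  obtain ⟨L, hL⟩ := cycle_L m
  have hc : Fintype.card (Fin (m + 2)) = m + 2 := Fintype.card_fin _
  constructor
  · intro h
    by_contra ho
    rw [Nat.not_odd_iff_even] at ho
    exact even_case _ (by omega) (by rwa [hc]) L hL h
  · intro ho
    exact odd_case _ (by omega) (by rwa [hc]) L hL
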